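/- For all reals t > 0 and M > 0 and every integer d ≥ 10, there exists a constant c(d,t,M) > 0 such that the following holds. Fix E ∈ [−M, M] and η ∈ (0,1), and set I = [E − η, E + η]. Then lim_{N→∞} P( |Λ_I| ≥ c·N·η ) = 1 and lim_{N→∞} P( |Λ_I| ≤ c^{−1}·N·η ) = 1, where |Λ_I| denotes the number of eigenvalues of W_N in I counted with multiplicity. -/

import Mathlib

open MeasureTheory ProbabilityTheory Matrix Filter
open scoped ENNReal NNReal Classical Real

noncomputable section

/-- `a` is the Boolean adjacency matrix of a simple `d`-regular graph on `Fin N`: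
symmetric, zero diagonal, every row sum equal to `d`. -/
def IsRegAdj (d N : ℕ) (a : Fin N → Fin N → Bool) : Prop :=
  (∀ i j, a i j = a j i) ∧ (∀ i, a i i = false) ∧
    (∀ i, (Finset.univ.filter (fun j => a i j = true)).card = d)

/-- The tight-binding Hamiltonian `W_N = -t A_N + diag(v)`. -/
def Wmat (t : ℝ) {N : ℕ} (a : Fin N → Fin N → Bool) (v : Fin N → ℝ) :
    Matrix (Fin N) (Fin N) ℝ :=
  fun i j => (if a i j then -t else 0) + (if i = j then v i else 0)

/-- The resMat `G(z) = (W - z)⁻¹` as a complex matrix. -/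
def resMat {N : ℕ} (z : ℂ) (W : Matrix (Fin N) (Fin N) ℝ) :
    Matrix (Fin N) (Fin N) ℂ :=
  (W.map (fun x => (x : ℂ)) - z • 1)⁻¹

/-- The law of `(A_N, (g_1,…,g_N))`: a uniformly random simple `d`-regular graph on `N`
vertices together with independent i.i.d. standard Gaussian potentials. -/
def graphMeasure (d N : ℕ) : Measure ((Fin N → Fin N → Bool) × (Fin N → ℝ)) :=
  (uniformOn {a | IsRegAdj d N a}).prod (Measure.pi fun _ => gaussianReal 0 1)

/-- `Im G_N(z)_{jj}` for the sample `ω = (A_N, v)`. -/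
def imG (t : ℝ) (z : ℂ) {N : ℕ} (ω : (Fin N → Fin N → Bool) × (Fin N → ℝ))
    (j : Fin N) : ℝ :=
  (resMat z (Wmat t ω.1 ω.2) j j).im

/-- The number of eigenvalues of `W` (with multiplicity) lying in the set `I`,
counted via the roots of the characteristic polynomial.  For a real symmetric
matrix the characteristic polynomial splits over `ℝ`, so this is the eigenvalue
count with multiplicity. -/
def eigCountIn {N : ℕ} (W : Matrix (Fin N) (Fin N) ℝ) (I : Set ℝ) : ℕ :=
  (W.charpoly.roots.filter (fun x => x ∈ I)).card

/-- The filter of admissible `N → ∞`: `N ≥ d+1` and `N·d` even. -/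
def admFilter (d : ℕ) : Filter ℕ :=
  atTop ⊓ Filter.principal {N | d + 1 ≤ N ∧ Even (N * d)}

def qf {n : ℕ} (B : Matrix (Fin n) (Fin n) ℝ) (x : Fin n → ℝ) : ℝ := x ⬝ᵥ (B *ᵥ x)

/-- number of eigenvalues below `c` -/
def cnt {n : ℕ} (B : Matrix (Fin n) (Fin n) ℝ) (c : ℝ) : ℕ :=
  (B.charpoly.roots.filter (fun x => x < c)).card

def NegOn {n : ℕ} (B : Matrix (Fin n) (Fin n) ℝ) (c : ℝ) (V : Submodule ℝ (Fin n → ℝ)) : Prop :=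
  ∀ x ∈ V, x ≠ 0 → qf B x < c * (x ⬝ᵥ x)

lemma card_roots_filter {n : ℕ} {B : Matrix (Fin n) (Fin n) ℝ} (hB : B.IsHermitian)
    (p : ℝ → Prop) :
    (B.charpoly.roots.filter p).card = Fintype.card {i // p (hB.eigenvalues i)} := by
  rw [hB.roots_charpoly_eq_eigenvalues, Fintype.card_subtype, Multiset.filter_map,
    Multiset.card_map]
  rfl

lemma exists_diag {n : ℕ} {B : Matrix (Fin n) (Fin n) ℝ} (hB : B.IsHermitian) :
    ∃ R : (Fin n → ℝ) ≃ₗ[ℝ] (Fin n → ℝ), ∀ x, qf B x = ∑ i, hB.eigenvalues i * (R x i) ^ 2 ∧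
      x ⬝ᵥ x = ∑ i, (R x i) ^ 2 := by
  set b := hB.eigenvectorBasis with hb
  let R : (Fin n → ℝ) ≃ₗ[ℝ] (Fin n → ℝ) :=
    ((WithLp.linearEquiv 2 ℝ (Fin n → ℝ)).symm.trans b.repr.toLinearEquiv).trans
      (WithLp.linearEquiv 2 ℝ (Fin n → ℝ))
  have hR : ∀ x i, R x i = b.repr (WithLp.toLp 2 x) i := fun x i => rfl
  have key : ∀ x y : Fin n → ℝ, x ⬝ᵥ y = ∑ i, R x i * R y i := by
    intro x y
    have h1 := b.repr.inner_map_map (WithLp.toLp 2 x) (WithLp.toLp 2 y)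
    simp only [PiLp.inner_apply, RCLike.inner_apply, conj_trivial] at h1
    simp only [hR, dotProduct]
    rw [Finset.sum_congr rfl (fun i _ => mul_comm (x i) (y i)), ← h1]
    exact Finset.sum_congr rfl (fun i _ => mul_comm _ _)
  refine ⟨R, fun x => ⟨?_, ?_⟩⟩
  · rw [qf, key]
    refine Finset.sum_congr rfl fun i _ => ?_
    have : R (B *ᵥ x) i = hB.eigenvalues i * R x i := by
      rw [hR, hR, b.repr_apply_apply, b.repr_apply_apply]
      have h2 := hB.mulVec_eigenvectorBasis i
      simp only [PiLp.inner_apply, RCLike.inner_apply, conj_trivial]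
      have h3 : (B *ᵥ x) ⬝ᵥ (⇑(b i)) = hB.eigenvalues i * (x ⬝ᵥ ⇑(b i)) := by
        rw [dotProduct_comm, Matrix.dotProduct_mulVec, ← Matrix.mulVec_transpose]
        have h4 : Bᵀ = B := by
          have h5 := hB
          simp only [Matrix.IsHermitian, Matrix.conjTranspose_eq_transpose_of_trivial] at h5
          exact h5
        rw [h4, h2, smul_dotProduct, smul_eq_mul, dotProduct_comm]
      exact h3
    rw [this]; ring
  · rw [key]
    exact Finset.sum_congr rfl (fun i _ => by ring)

lemma exists_negOn {n : ℕ} {B : Matrix (Fin n) (Fin n) ℝ} (hB : B.IsHermitian) (c : ℝ) :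
    ∃ V, NegOn B c V ∧ Module.finrank ℝ V = cnt B c := by
  obtain ⟨R, hR⟩ := exists_diag hB
  let S := {i // hB.eigenvalues i < c}
  let L : (S → ℝ) →ₗ[ℝ] (Fin n → ℝ) :=
    { toFun := fun f i => if h : hB.eigenvalues i < c then f ⟨i, h⟩ else 0
      map_add' := by intro f g; ext i; by_cases h : hB.eigenvalues i < c <;> simp [h]
      map_smul' := by intro r g; ext i; by_cases h : hB.eigenvalues i < c <;> simp [h] }
  have hL : ∀ f i, L f i = if h : hB.eigenvalues i < c then f ⟨i, h⟩ else 0 := fun _ _ => rfl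
  have hinj : Function.Injective (R.symm.toLinearMap ∘ₗ L) := by
    refine R.symm.injective.comp ?_
    intro f g hfg
    ext ⟨i, hi⟩
    have := congrFun hfg i
    simpa [hL, hi] using this
  refine ⟨LinearMap.range (R.symm.toLinearMap ∘ₗ L), ?_, ?_⟩
  · rintro _ ⟨f, rfl⟩ hne
    have hf : L f ≠ 0 := by
      intro h; apply hne; simp [h]
    rw [(hR _).1, (hR _).2, Finset.mul_sum]
    simp only [LinearMap.comp_apply, LinearEquiv.coe_coe, LinearEquiv.apply_symm_apply]
    obtain ⟨i, hi⟩ := Function.ne_iff.mp hf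
    refine Finset.sum_lt_sum (fun k _ => ?_) ⟨i, Finset.mem_univ _, ?_⟩
    · by_cases h : hB.eigenvalues k < c
      · exact mul_le_mul_of_nonneg_right h.le (sq_nonneg _)
      · simp [hL, h]
    · have h : hB.eigenvalues i < c := by
        by_contra h; apply hi; simp [hL, h]
      exact mul_lt_mul_of_pos_right h (by have : L f i ≠ 0 := hi
                                          positivity)
  · rw [LinearMap.finrank_range_of_inj hinj, Module.finrank_fintype_fun_eq_card, cnt,
      card_roots_filter hB]

lemma finrank_le_cnt {n : ℕ} {B : Matrix (Fin n) (Fin n) ℝ} (hB : B.IsHermitian) {c : ℝ}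
    {V : Submodule ℝ (Fin n → ℝ)} (hV : NegOn B c V) : Module.finrank ℝ V ≤ cnt B c := by
  obtain ⟨R, hR⟩ := exists_diag hB
  let S := {i // hB.eigenvalues i < c}
  let L : V →ₗ[ℝ] (S → ℝ) :=
    (LinearMap.funLeft ℝ ℝ (Subtype.val : S → Fin n)) ∘ₗ R.toLinearMap ∘ₗ V.subtype
  have hinj : Function.Injective L := by
    rw [← LinearMap.ker_eq_bot, LinearMap.ker_eq_bot']
    rintro ⟨x, hx⟩ h
    by_contra hne
    have hx0 : x ≠ 0 := fun h => hne (by simp [h])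
    have := hV x hx hx0
    rw [(hR _).1, (hR _).2, Finset.mul_sum] at this
    refine absurd this (not_lt.mpr (Finset.sum_le_sum fun i _ => ?_))
    by_cases hi : hB.eigenvalues i < c
    · have h5 : R x i = 0 := congrFun h (⟨i, hi⟩ : S)
      simp [h5]
    · exact mul_le_mul_of_nonneg_right (not_lt.mp hi) (sq_nonneg _)
  have := LinearMap.finrank_le_finrank_of_injective hinj
  rwa [Module.finrank_fintype_fun_eq_card, ← card_roots_filter hB (fun x => x < c)] at this

lemma cnt_mono {n : ℕ} {B B' : Matrix (Fin n) (Fin n) ℝ} (hB : B.IsHermitian)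
    (hB' : B'.IsHermitian) {c c' : ℝ}
    (h : ∀ x, qf B x - c * (x ⬝ᵥ x) ≤ qf B' x - c' * (x ⬝ᵥ x)) : cnt B' c' ≤ cnt B c := by
  obtain ⟨V, hV, hd⟩ := exists_negOn hB' c'
  rw [← hd]
  apply finrank_le_cnt hB
  intro x hx h0
  have := hV x hx h0
  have := h x
  linarith

lemma cnt_le {n : ℕ} {B : Matrix (Fin n) (Fin n) ℝ} (hB : B.IsHermitian) (c : ℝ) :
    cnt B c ≤ n := by
  obtain ⟨V, hV, hd⟩ := exists_negOn hB c
  rw [← hd]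
  simpa using V.finrank_le

/-- changing the form off a coordinate hyperplane changes the count by at most one -/
lemma cnt_rank_one {n : ℕ} {B B' : Matrix (Fin n) (Fin n) ℝ} (hB : B.IsHermitian)
    (hB' : B'.IsHermitian) {c : ℝ} (j : Fin n)
    (h : ∀ x : Fin n → ℝ, x j = 0 → qf B x ≤ qf B' x) : cnt B' c ≤ cnt B c + 1 := by
  obtain ⟨V, hV, hd⟩ := exists_negOn hB' c
  rw [← hd]
  let f : V →ₗ[ℝ] ℝ := (LinearMap.proj j) ∘ₗ V.subtype
  have h1 := f.finrank_range_add_finrank_ker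
  have h2 : Module.finrank ℝ (LinearMap.range f) ≤ 1 := by
    simpa using (LinearMap.range f).finrank_le
  have h3 : Module.finrank ℝ (LinearMap.ker f) ≤ cnt B c := by
    rw [← Submodule.finrank_map_subtype_eq V (LinearMap.ker f)]
    apply finrank_le_cnt hB
    intro x hx h0
    obtain ⟨⟨y, hy⟩, hyk, rfl⟩ := hx
    have h5 := hV y hy h0
    have h6 := h y hyk
    simp only [Submodule.subtype_apply]
    linarith
  omega

def nn {n : ℕ} (A : Matrix (Fin n) (Fin n) ℝ) (u : Fin n → ℝ) : ℕ := cnt (A + diagonal u) 0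

lemma herm_add {n : ℕ} {A : Matrix (Fin n) (Fin n) ℝ} (hA : ∀ i k, A i k = A k i)
    (u : Fin n → ℝ) : (A + diagonal u).IsHermitian := by
  ext i k
  simp only [conjTranspose_apply, Matrix.add_apply, star_trivial, diagonal_apply, hA i k]
  by_cases h : i = k
  · subst h; simp
  · simp [h, Ne.symm h]

lemma qf_add {n : ℕ} (A : Matrix (Fin n) (Fin n) ℝ) (u x : Fin n → ℝ) :
    qf (A + diagonal u) x = qf A x + ∑ i, u i * x i ^ 2 := by
  rw [qf, qf, Matrix.add_mulVec, dotProduct_add]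
  congr 1
  simp only [dotProduct, mulVec_diagonal]
  exact Finset.sum_congr rfl fun i _ => by ring

lemma nn_anti {n : ℕ} {A : Matrix (Fin n) (Fin n) ℝ} (hA : ∀ i k, A i k = A k i) :
    Antitone (nn A) := by
  intro u w h
  refine cnt_mono (herm_add hA _) (herm_add hA _) fun x => ?_
  simp only [qf_add, zero_mul, sub_zero]
  gcongr with i
  exact h i

lemma nn_le {n : ℕ} {A : Matrix (Fin n) (Fin n) ℝ} (hA : ∀ i k, A i k = A k i)
    (u : Fin n → ℝ) : nn A u ≤ n := cnt_le (herm_add hA _) _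

lemma nn_osc {n : ℕ} {A : Matrix (Fin n) (Fin n) ℝ} (hA : ∀ i k, A i k = A k i)
    (u : Fin n → ℝ) (j : Fin n) (a b : ℝ) :
    nn A (Function.update u j a) ≤ nn A (Function.update u j b) + 1 := by
  refine cnt_rank_one (herm_add hA _) (herm_add hA _) j fun x hx => ?_
  simp only [qf_add]
  refine add_le_add le_rfl (Finset.sum_le_sum fun i _ => ?_)
  by_cases h : i = j
  · subst h; simp [hx]
  · simp [h]

lemma cnt_eq_nn {n : ℕ} {A : Matrix (Fin n) (Fin n) ℝ} (hA : ∀ i k, A i k = A k i)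
    (u : Fin n → ℝ) (c : ℝ) : cnt (A + diagonal u) c = nn A (fun i => u i - c) := by
  have h : ∀ x, qf (A + diagonal u) x - c * (x ⬝ᵥ x) =
      qf (A + diagonal (fun i => u i - c)) x - 0 * (x ⬝ᵥ x) := by
    intro x
    simp only [qf_add, dotProduct, sub_mul, Finset.sum_sub_distrib, Finset.mul_sum, zero_mul]
    simp only [pow_two, Finset.sum_const_zero]; ring
  apply le_antisymm
  · exact cnt_mono (herm_add hA _) (herm_add hA _) fun x => (h x).ge
  · exact cnt_mono (herm_add hA _) (herm_add hA _) fun x => (h x).le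

lemma exists_cnt_eq {n : ℕ} {B : Matrix (Fin n) (Fin n) ℝ} :
    ∃ ε > 0, cnt B (-ε) = cnt B 0 := by
  have h : ∀ᶠ ε in nhdsWithin (0 : ℝ) (Set.Ioi 0), ∀ x ∈ B.charpoly.roots.toFinset,
      (x < -ε ↔ x < 0) := by
    rw [Filter.eventually_all_finset]
    intro x _
    by_cases hx : x < 0
    · have : ∀ᶠ ε in nhdsWithin (0 : ℝ) (Set.Ioi 0), ε < -x :=
        nhdsWithin_le_nhds (eventually_lt_nhds (by linarith))
      filter_upwards [this] with ε hε
      constructor <;> intro <;> linarith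
    · filter_upwards [self_mem_nhdsWithin] with ε hε
      have : 0 < ε := hε
      constructor <;> intro <;> linarith
  obtain ⟨ε, h1, h2⟩ := (h.and self_mem_nhdsWithin).exists
  refine ⟨ε, h2, ?_⟩
  unfold cnt
  have h3 : ∀ x ∈ B.charpoly.roots, (x < -ε ↔ x < 0) := fun x hx => h1 x (by simpa using hx)
  rw [Multiset.filter_congr h3]

lemma nn_meas {n : ℕ} {A : Matrix (Fin n) (Fin n) ℝ} (hA : ∀ i k, A i k = A k i) :
    Measurable (nn A) := by
  refine measurable_of_Ici fun k => IsOpen.measurableSet ?_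
  rw [isOpen_iff_mem_nhds]
  intro u hu
  obtain ⟨ε, hε, h⟩ := exists_cnt_eq (B := A + diagonal u)
  rw [cnt_eq_nn hA] at h
  have : ∀ᶠ w in nhds u, ∀ i, w i < u i + ε := by
    rw [Filter.eventually_all]
    intro i
    exact (continuous_apply i).continuousAt.eventually (eventually_lt_nhds (by linarith))
  filter_upwards [this] with w hw
  simp only [Set.mem_preimage, Set.mem_Ici] at hu ⊢
  refine hu.trans (le_trans (le_of_eq ?_) (nn_anti hA (fun i => ?_ : w ≤ fun i => u i - -ε)))
  · exact h.symm
  · have := hw i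
    simp only; linarith

def dec {n : ℕ} (A : Matrix (Fin n) (Fin n) ℝ) (j : Fin n) : Matrix (Fin n) (Fin n) ℝ :=
  fun i k => if i = j ∨ k = j then 0 else A i k

lemma dec_symm {n : ℕ} {A : Matrix (Fin n) (Fin n) ℝ} (hA : ∀ i k, A i k = A k i) (j : Fin n) :
    ∀ i k, dec A j i k = dec A j k i := by
  intro i k
  simp only [dec, hA i k, or_comm]

lemma qf_dec {n : ℕ} {A : Matrix (Fin n) (Fin n) ℝ} (hA : ∀ i k, A i k = A k i) (j : Fin n)
    (hj : A j j = 0) (x : Fin n → ℝ) :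
    qf A x = qf (dec A j) x + 2 * x j * ∑ k, A j k * x k := by
  have h : ∀ i k, A i k = dec A j i k + (if i = j then A j k else 0)
      + (if k = j then A j i else 0) := by
    intro i k
    simp only [dec]
    by_cases h1 : i = j <;> by_cases h2 : k = j
    · subst h1; subst h2; simp [hj]
    · subst h1; simp [h2]
    · subst h2; simp [h1, hA i k]
    · simp [h1, h2]
  have e : ∀ i, (A *ᵥ x) i = (dec A j *ᵥ x) i + (if i = j then ∑ k, A j k * x k else 0)
      + A j i * x j := by
    intro i
    simp only [mulVec, dotProduct]
    rw [Finset.sum_congr rfl (fun k _ => by rw [h i k])]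
    simp only [add_mul, Finset.sum_add_distrib, ite_mul, zero_mul]
    congr 1
    · congr 1
      split_ifs <;> simp
    · simp
  rw [qf, qf]
  simp only [dotProduct, e, mul_add, Finset.sum_add_distrib, mul_ite, mul_zero,
    Finset.sum_ite_eq', Finset.mem_univ, if_true]
  rw [show ∑ i, x i * (A j i * x j) = x j * ∑ k, A j k * x k by
    rw [Finset.mul_sum]; exact Finset.sum_congr rfl fun i _ => by ring]
  ring

lemma qf_dec_update {n : ℕ} (A : Matrix (Fin n) (Fin n) ℝ) (j : Fin n)
    (x : Fin n → ℝ) (a : ℝ) :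
    qf (dec A j) (Function.update x j a) = qf (dec A j) x := by
  simp only [qf, dotProduct, mulVec, dec]
  refine Finset.sum_congr rfl fun i _ => ?_
  by_cases h : i = j
  · simp [h]
  · simp only [h, ne_eq, not_false_eq_true, Function.update_of_ne, false_or]
    congr 1
    refine Finset.sum_congr rfl fun k _ => ?_
    by_cases h2 : k = j
    · simp [h2]
    · simp [h2]

lemma sum_update {n : ℕ} (u x : Fin n → ℝ) (j : Fin n) (a : ℝ) :
    ∑ i, Function.update u j a i * x i ^ 2 = a * x j ^ 2 + ∑ i ∈ Finset.univ.erase j, u i * x i ^ 2 := by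
  rw [← Finset.add_sum_erase _ _ (Finset.mem_univ j)]
  congr 1
  · simp
  · refine Finset.sum_congr rfl fun i hi => ?_
    rw [Function.update_of_ne (Finset.ne_of_mem_erase hi)]

lemma cnt_add_one {n : ℕ} {A : Matrix (Fin n) (Fin n) ℝ} (hA : ∀ i k, A i k = A k i) (j : Fin n)
    (u : Fin n → ℝ) :
    nn (dec A j) (Function.update u j 1) + 1 ≤ nn (dec A j) (Function.update u j (-1)) := by
  have hD := dec_symm hA j
  obtain ⟨V, hV, hd⟩ := exists_negOn (herm_add hD (Function.update u j 1)) 0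
  let T : V × ℝ →ₗ[ℝ] (Fin n → ℝ) :=
    { toFun := fun p => Function.update p.1.1 j p.2
      map_add' := by
        intro p q; ext i; by_cases h : i = j
        · subst h; simp
        · simp [h]
      map_smul' := by
        intro p q; ext i; by_cases h : i = j
        · subst h; simp
        · simp [h] }
  have hT : ∀ p, T p = Function.update p.1.1 j p.2 := fun _ => rfl
  have e1 : ∀ x a, qf (dec A j + diagonal (Function.update u j (-1))) (Function.update x j a) =
      qf (dec A j + diagonal (Function.update u j 1)) x - x j ^ 2 - a ^ 2 := by
    intro x a
    rw [qf_add, qf_add, sum_update, sum_update, qf_dec_update]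
    rw [Finset.sum_congr rfl (g := fun i => u i * x i ^ 2)]
    · simp; ring
    · intro i hi
      rw [Function.update_of_ne (Finset.ne_of_mem_erase hi)]
  have hneg : ∀ p, p ≠ 0 →
      qf (dec A j + diagonal (Function.update u j (-1))) (T p) < 0 := by
    rintro ⟨⟨x, hx⟩, a⟩ hp
    rw [hT, e1]
    simp only
    by_cases h0 : x = 0
    · have ha : a ≠ 0 := by
        rintro rfl; apply hp; subst h0; rfl
      subst h0
      have : 0 < a ^ 2 := by positivity
      simp [qf, this]
    · have := hV x hx h0
      have h1 := sq_nonneg (x j)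
      have h2 := sq_nonneg a
      linarith
  have hinj : Function.Injective T := by
    rw [← LinearMap.ker_eq_bot, LinearMap.ker_eq_bot']
    intro p hp
    by_contra hne
    have := hneg p hne
    rw [hp] at this
    simp [qf] at this
  have h1 : Module.finrank ℝ (LinearMap.range T) = nn (dec A j) (Function.update u j 1) + 1 := by
    rw [LinearMap.finrank_range_of_inj hinj, Module.finrank_prod, hd]
    simp [nn]
  rw [← h1]
  apply finrank_le_cnt (herm_add hD _)
  rintro _ ⟨p, rfl⟩ h0
  rw [zero_mul]
  apply hneg
  rintro rfl
  exact h0 (map_zero T)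

lemma cross_bound {n : ℕ} {A : Matrix (Fin n) (Fin n) ℝ} (j : Fin n) (S : Finset (Fin n))
    (hS : ∀ k, k ∉ S → A j k = 0) {t δ K : ℝ} (ht : ∀ k, |A j k| ≤ t) (hδ : 0 < δ)
    (hK : 1 + S.card * t ^ 2 / δ ≤ K) (x : Fin n → ℝ) :
    |2 * x j * ∑ k, A j k * x k| ≤ (K - 1) * x j ^ 2 + ∑ k ∈ S, δ * x k ^ 2 := by
  have h1 : ∑ k, A j k * x k = ∑ k ∈ S, A j k * x k := by
    symm
    apply Finset.sum_subset (Finset.subset_univ _)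
    intro k _ hk
    simp [hS k hk]
  rw [h1, Finset.mul_sum]
  have ht0 : 0 ≤ t := (abs_nonneg _).trans (ht j)
  calc |∑ k ∈ S, 2 * x j * (A j k * x k)| ≤ ∑ k ∈ S, |2 * x j * (A j k * x k)| :=
        Finset.abs_sum_le_sum_abs _ _
    _ ≤ ∑ k ∈ S, (t ^ 2 / δ * x j ^ 2 + δ * x k ^ 2) := by
        refine Finset.sum_le_sum fun k _ => ?_
        have h2 : |2 * x j * (A j k * x k)| ≤ 2 * t * (|x j| * |x k|) := by
          rw [abs_mul, abs_mul, abs_mul, abs_two]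
          have := mul_le_mul_of_nonneg_left (ht k) (by positivity : 0 ≤ 2 * |x j| * |x k|)
          linarith
        refine h2.trans ?_
        have h3 : t ^ 2 / δ * x j ^ 2 + δ * x k ^ 2 - 2 * t * (|x j| * |x k|) =
          (t * |x j| - δ * |x k|) ^ 2 / δ := by
          field_simp
          rw [← sq_abs (x j), ← sq_abs (x k)]; ring
        have : 0 ≤ (t * |x j| - δ * |x k|) ^ 2 / δ := by positivity
        linarith
    _ = (S.card * t ^ 2 / δ) * x j ^ 2 + ∑ k ∈ S, δ * x k ^ 2 := by
        rw [Finset.sum_add_distrib]; simp; ring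
    _ ≤ _ := by
        gcongr; linarith

lemma decouple {n : ℕ} {A : Matrix (Fin n) (Fin n) ℝ} (hA : ∀ i k, A i k = A k i) (j : Fin n)
    (hj : A j j = 0) (S : Finset (Fin n)) (hjS : j ∉ S)
    (hS : ∀ k, k ∉ S → A j k = 0) {t δ K : ℝ} (ht : ∀ k, |A j k| ≤ t) (hδ : 0 < δ)
    (hK : 1 + S.card * t ^ 2 / δ ≤ K) (u : Fin n → ℝ) :
    nn A (Function.update u j K) + nn (dec A j) (Function.update (fun i => u i + if i ∈ S then δ else 0) j 1) + 1
      ≤ nn A (Function.update u j (-K)) +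
        nn (dec A j) (Function.update (fun i => u i - if i ∈ S then δ else 0) j 1) := by
  have hD := dec_symm hA j
  have hsum : ∀ x : Fin n → ℝ, ∑ k ∈ S, δ * x k ^ 2 =
      ∑ k ∈ Finset.univ.erase j, (if k ∈ S then δ else 0) * x k ^ 2 := by
    intro x
    simp only [ite_mul, zero_mul]
    rw [← Finset.sum_filter]
    congr 1
    ext k
    simp only [Finset.mem_filter, Finset.mem_erase, Finset.mem_univ, and_true]
    constructor
    · intro h; exact ⟨fun h' => hjS (h' ▸ h), h⟩
    · exact fun h => h.2
  have a1 : nn A (Function.update u j K) ≤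
      nn (dec A j) (Function.update (fun i => u i - if i ∈ S then δ else 0) j 1) := by
    refine cnt_mono (herm_add hD _) (herm_add hA _) fun x => ?_
    rw [qf_add, qf_add, sum_update, sum_update, qf_dec hA j hj x]
    simp only [sub_mul, Finset.sum_sub_distrib]
    have := cross_bound j S hS ht hδ hK x
    rw [hsum] at this
    have := neg_le_of_abs_le this
    linarith
  have a2 : nn (dec A j) (Function.update (fun i => u i + if i ∈ S then δ else 0) j (-1)) ≤
      nn A (Function.update u j (-K)) := by
    refine cnt_mono (herm_add hA _) (herm_add hD _) fun x => ?_
    rw [qf_add, qf_add, sum_update, sum_update, qf_dec hA j hj x]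
    simp only [add_mul, Finset.sum_add_distrib]
    have := cross_bound j S hS ht hδ hK x
    rw [hsum] at this
    have := le_of_abs_le this
    linarith
  have a3 := cnt_add_one hA j (fun i => u i + if i ∈ S then δ else 0)
  omega

abbrev gam : Measure ℝ := gaussianReal 0 1

abbrev PP (n : ℕ) : Measure (Fin n → ℝ) := Measure.pi (fun _ => gaussianReal 0 1)

lemma resample {n : ℕ} (j : Fin n) :
    MeasurePreserving (fun p : (Fin n → ℝ) × ℝ => Function.update p.1 j p.2)
      ((PP n).prod gam) (PP n) := by
  have hm : Measurable (fun p : (Fin n → ℝ) × ℝ => Function.update p.1 j p.2) := by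
    rw [measurable_pi_iff]
    intro i
    by_cases h : i = j
    · subst h; simpa using measurable_snd
    · simp only [ne_eq, h, not_false_eq_true, Function.update_of_ne]
      exact (measurable_pi_apply i).comp measurable_fst
  refine ⟨hm, ?_⟩
  symm
  refine Measure.pi_eq fun s hs => ?_
  rw [Measure.map_apply hm (MeasurableSet.univ_pi hs)]
  have : (fun p : (Fin n → ℝ) × ℝ => Function.update p.1 j p.2) ⁻¹' (Set.univ.pi s) =
      (Set.univ.pi (Function.update s j Set.univ)) ×ˢ (s j) := by
    ext ⟨v, x⟩
    simp only [Set.mem_preimage, Set.mem_pi, Set.mem_univ, true_imp_iff, Set.mem_prod]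
    constructor
    · intro h
      refine ⟨fun i => ?_, by simpa using h j⟩
      by_cases hi : i = j
      · subst hi; simp
      · simpa [hi] using h i
    · rintro ⟨h, hx⟩ i
      by_cases hi : i = j
      · subst hi; simpa using hx
      · simpa [hi] using h i
  rw [this, Measure.prod_prod, Measure.pi_pi]
  rw [← Finset.mul_prod_erase _ _ (Finset.mem_univ j),
    ← Finset.mul_prod_erase _ (fun i => gam (s i)) (Finset.mem_univ j)]
  simp only [Function.update_self, measure_univ, one_mul]
  rw [mul_comm]
  congr 1
  refine Finset.prod_congr rfl fun i hi => ?_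
  rw [Function.update_of_ne (Finset.ne_of_mem_erase hi)]

lemma integral_resample {n : ℕ} (j : Fin n) {f : (Fin n → ℝ) → ℝ} (hf : Integrable f (PP n)) :
    ∫ v, f v ∂(PP n) = ∫ v, ∫ x, f (Function.update v j x) ∂gam ∂(PP n) := by
  have h1 := (resample j)
  have h2 : Integrable (fun p : (Fin n → ℝ) × ℝ => f (Function.update p.1 j p.2))
      ((PP n).prod gam) := h1.integrable_comp_of_integrable hf
  rw [← integral_prod _ h2]
  conv_lhs => rw [← h1.map_eq]
  rw [integral_map h1.measurable.aemeasurable]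
  rw [h1.map_eq]; exact hf.1

lemma integrable_resample {n : ℕ} (j : Fin n) {f : (Fin n → ℝ) → ℝ} (hf : Integrable f (PP n)) :
    Integrable (fun v => ∫ x, f (Function.update v j x) ∂gam) (PP n) :=
  ((resample j).integrable_comp_of_integrable hf).integral_prod_left

lemma gam_le (s : Set ℝ) : gam s ≤ volume s := by
  rw [gaussianReal_apply 0 one_ne_zero]
  calc ∫⁻ x in s, gaussianPDF 0 1 x ≤ ∫⁻ x in s, 1 := by
        refine lintegral_mono fun x => ?_
        rw [gaussianPDF, ← ENNReal.ofReal_one]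
        apply ENNReal.ofReal_le_ofReal
        rw [gaussianPDFReal]
        have h1 : Real.exp (-(x - 0) ^ 2 / (2 * ((1 : ℝ≥0) : ℝ))) ≤ 1 := by
          rw [Real.exp_le_one_iff]
          have := sq_nonneg (x - 0)
          apply div_nonpos_of_nonpos_of_nonneg <;> simp; positivity
        have h2 : (√(2 * π * ((1 : ℝ≥0) : ℝ)))⁻¹ ≤ 1 := by
          apply inv_le_one_of_one_le₀
          rw [Real.one_le_sqrt]
          have := Real.pi_gt_three
          simp; linarith
        calc _ ≤ (1 : ℝ) * 1 := mul_le_mul h2 h1 (by positivity) (by norm_num)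
          _ = 1 := one_mul 1
    _ = volume s := by simp

def phi (R : ℝ) : ℝ := gaussianPDFReal 0 1 R

lemma phi_pos (R : ℝ) : 0 < phi R := gaussianPDFReal_pos _ _ _ one_ne_zero

lemma gam_ge {s : Set ℝ} (hs : MeasurableSet s) {R : ℝ} (h : ∀ x ∈ s, |x| ≤ R) :
    ENNReal.ofReal (phi R) * volume s ≤ gam s := by
  rw [gaussianReal_apply 0 one_ne_zero]
  calc ENNReal.ofReal (phi R) * volume s = ∫⁻ x in s, ENNReal.ofReal (phi R) := by simp
    _ ≤ _ := by
      refine setLIntegral_mono' hs fun x hx => ?_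
      rw [gaussianPDF]
      apply ENNReal.ofReal_le_ofReal
      rw [phi, gaussianPDFReal, gaussianPDFReal]
      gcongr 3
      have := h x hx
      rw [sub_zero, sub_zero, neg_le_neg_iff]
      rw [← sq_abs x]
      gcongr

lemma integral_diff {h : ℝ → ℕ} (ha : Antitone h) (ho : ∀ a b, h a ≤ h b + 1) {w : ℝ}
    (hw : 0 ≤ w) : ∫ x, ((h x : ℝ) - h (x + w)) ∂gam = (gam {x | h (x + w) < h x}).toReal := by
  have hm : Measurable h := ha.measurable
  have hU : MeasurableSet {x | h (x + w) < h x} :=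
    measurableSet_lt (hm.comp (measurable_id.add_const w)) hm
  have : (fun x => ((h x : ℝ) - h (x + w))) = Set.indicator {x | h (x + w) < h x} 1 := by
    funext x
    by_cases hx : h (x + w) < h x
    · rw [Set.indicator_of_mem (by exact hx)]
      have h1 : h x = h (x + w) + 1 := by have := ho x (x + w); omega
      rw [h1]; simp
    · rw [Set.indicator_of_notMem (by exact hx)]
      have h1 : h x = h (x + w) := le_antisymm (not_lt.mp hx) (ha (by linarith))
      rw [← h1]; simp
  rw [this, integral_indicator_one hU]
  rfl

lemma oneD_upper {h : ℝ → ℕ} (ha : Antitone h) (ho : ∀ a b, h a ≤ h b + 1) {w : ℝ}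
    (hw : 0 ≤ w) : ∫ x, ((h x : ℝ) - h (x + w)) ∂gam ≤ w := by
  rw [integral_diff ha ho hw]
  apply ENNReal.toReal_le_of_le_ofReal hw
  refine (gam_le _).trans ((Real.volume_le_diam _).trans ?_)
  apply Metric.ediam_le
  have key : ∀ x ∈ {x | h (x + w) < h x}, ∀ y ∈ {x | h (x + w) < h x}, y - x ≤ w := by
    intro x hx y hy
    by_contra hc
    push Not at hc
    simp only [Set.mem_ofPred_eq] at hx hy
    have h1 : h y ≤ h (x + w) := ha (by linarith)
    have h2 := ho x (y + w)
    omega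
  intro x hx y hy
  rw [edist_dist, Real.dist_eq]
  apply ENNReal.ofReal_le_ofReal
  rw [abs_le]
  have := key x hx y hy
  have := key y hy x hx
  constructor <;> linarith

lemma oneD_lower {h : ℝ → ℕ} (ha : Antitone h) (ho : ∀ a b, h a ≤ h b + 1) {w R a b : ℝ}
    (hw : 0 ≤ w) (hab : a ≤ b) (haR : -R + w ≤ a) (hbR : b ≤ R) :
    w * phi R * ((h a : ℝ) - h b) ≤ ∫ x, ((h x : ℝ) - h (x + w)) ∂gam := by
  rw [integral_diff ha ho hw]
  by_cases hlt : h b < h a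
  · have h1 : h a = h b + 1 := by have := ho a b; omega
    have e1 : (h a : ℝ) - h b = 1 := by rw [h1]; simp
    rw [e1, mul_one]
    set T := {x | h b < h x} with hT
    have hbd : ∀ x ∈ T, x ≤ b := by
      intro x hx
      by_contra hc
      have : h x ≤ h b := ha (le_of_not_ge hc)
      exact absurd hx (not_lt.mpr this)
    have hBA : BddAbove T := ⟨b, hbd⟩
    set κ := sSup T with hκ
    have hκb : κ ≤ b := csSup_le ⟨a, hlt⟩ hbd
    have hκa : a ≤ κ := le_csSup hBA hlt
    have hsub : Set.Ioo (κ - w) κ ⊆ {x | h (x + w) < h x} := by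
      intro x hx
      have h2 : ¬ (h b < h (x + w)) := by
        intro hc
        have : x + w ≤ κ := le_csSup hBA hc
        linarith [hx.1]
      obtain ⟨y, hy, hxy⟩ := exists_lt_of_lt_csSup ⟨a, hlt⟩ hx.2
      have h3 : h y ≤ h x := ha hxy.le
      have h4 : h b < h y := hy
      simp only [Set.mem_ofPred_eq]
      omega
    have h5 : ENNReal.ofReal (phi R) * volume (Set.Ioo (κ - w) κ) ≤ gam (Set.Ioo (κ - w) κ) := by
      apply gam_ge measurableSet_Ioo
      intro x hx
      rw [abs_le]
      constructor <;> linarith [hx.1, hx.2]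
    rw [Real.volume_Ioo, ← ENNReal.ofReal_mul (phi_pos R).le] at h5
    have h6 := h5.trans (measure_mono hsub)
    have h7 := ENNReal.toReal_mono (measure_ne_top _ _) h6
    rw [ENNReal.toReal_ofReal (mul_nonneg (phi_pos R).le (by linarith))] at h7
    linarith
  · have h1 : h a = h b := le_antisymm (not_lt.mp hlt) (ha hab)
    rw [h1]; simp

structure Good {n : ℕ} (g : (Fin n → ℝ) → ℕ) : Prop where
  anti : Antitone g
  meas : Measurable g
  osc : ∀ u j a b, g (Function.update u j a) ≤ g (Function.update u j b) + 1
  le : ∀ u, g u ≤ n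

lemma good_nn {n : ℕ} {A : Matrix (Fin n) (Fin n) ℝ} (hA : ∀ i k, A i k = A k i) :
    Good (nn A) := ⟨nn_anti hA, nn_meas hA, nn_osc hA, nn_le hA⟩

lemma good_dec {n : ℕ} {A : Matrix (Fin n) (Fin n) ℝ} (hA : ∀ i k, A i k = A k i) (j : Fin n) :
    Good (fun u => nn (dec A j) (Function.update u j 1)) := by
  have hg := good_nn (dec_symm hA j)
  refine ⟨?_, ?_, ?_, fun u => hg.le _⟩
  · intro u w h
    apply hg.anti
    intro i
    by_cases hi : i = j
    · subst hi; simp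
    · simpa [hi] using h i
  · refine hg.meas.comp ?_
    rw [measurable_pi_iff]
    intro i
    by_cases h : i = j
    · subst h; simp
    · simp only [ne_eq, h, not_false_eq_true, Function.update_of_ne]
      exact measurable_pi_apply i
  · intro u k a b
    by_cases hk : k = j
    · subst hk; simp
    · rw [Function.update_comm hk, Function.update_comm hk]
      exact hg.osc _ _ _ _

lemma Good.meas' {n : ℕ} {g : (Fin n → ℝ) → ℕ} (hg : Good g) (c : Fin n → ℝ) :
    Measurable (fun v => (g (v + c) : ℝ)) :=
  (measurable_from_top (f := (Nat.cast : ℕ → ℝ))).comp (hg.meas.comp (measurable_id.add_const c))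

lemma Good.int {n : ℕ} {g : (Fin n → ℝ) → ℕ} (hg : Good g) (c : Fin n → ℝ) :
    Integrable (fun v => (g (v + c) : ℝ)) (PP n) := by
  refine Integrable.of_bound (hg.meas' c).aestronglyMeasurable (n : ℝ) (ae_of_all _ fun v => ?_)
  rw [Real.norm_of_nonneg (by positivity)]
  exact_mod_cast hg.le _

lemma Good.int2 {n : ℕ} {g : (Fin n → ℝ) → ℕ} (hg : Good g) (c c' : Fin n → ℝ) :
    Integrable (fun v => (g (v + c) : ℝ) - g (v + c')) (PP n) := (hg.int c).sub (hg.int c')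

lemma update_add_single {n : ℕ} (v c : Fin n → ℝ) (j : Fin n) (x w : ℝ) :
    Function.update v j x + (c + Pi.single j w) = Function.update (v + c) j (x + c j + w) := by
  ext i
  by_cases h : i = j
  · subst h; simp; ring
  · simp [h]

lemma update_add' {n : ℕ} (v c : Fin n → ℝ) (j : Fin n) (x : ℝ) :
    Function.update v j x + c = Function.update (v + c) j (x + c j) := by
  ext i
  by_cases h : i = j
  · subst h; simp
  · simp [h]

lemma Good.line {n : ℕ} {g : (Fin n → ℝ) → ℕ} (hg : Good g) (u : Fin n → ℝ) (j : Fin n) (s : ℝ) :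
    Antitone (fun x => g (Function.update u j (x + s))) := by
  intro x y h
  apply hg.anti
  intro i
  by_cases hi : i = j
  · subst hi; simpa using h
  · simp [hi]

lemma Good.site_upper {n : ℕ} {g : (Fin n → ℝ) → ℕ} (hg : Good g) (c : Fin n → ℝ) (j : Fin n)
    {w : ℝ} (hw : 0 ≤ w) :
    ∫ v, ((g (v + c) : ℝ) - g (v + (c + Pi.single j w))) ∂(PP n) ≤ w := by
  rw [integral_resample j (hg.int2 _ _)]
  have : ∀ v, ∫ x, ((g (Function.update v j x + c) : ℝ) -
      g (Function.update v j x + (c + Pi.single j w))) ∂gam ≤ w := by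
    intro v
    have := oneD_upper (hg.line (v + c) j (c j)) (fun a b => hg.osc _ _ _ _) hw
    simp only [update_add_single]
    simp only [update_add' v c]
    simp only [add_right_comm _ w (c j)] at this
    exact this
  calc _ ≤ ∫ v, w ∂(PP n) :=
        integral_mono (integrable_resample j (hg.int2 _ _)) (integrable_const _) this
    _ = w := by simp

lemma Good.site_lower {n : ℕ} {g : (Fin n → ℝ) → ℕ} (hg : Good g) (c : Fin n → ℝ) (j : Fin n)
    {w K R q : ℝ} (hw : 0 ≤ w) (hK : 0 ≤ K) (hR : K + w + |c j| ≤ R)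
    {F : (Fin n → ℝ) → ℝ} (hF : Integrable F (PP n)) (hq : q ≤ ∫ v, F v ∂(PP n))
    (hF' : ∀ v, F v ≤ (g (Function.update (v + c) j (-K)) : ℝ) - g (Function.update (v + c) j K)) :
    w * phi R * q ≤ ∫ v, ((g (v + c) : ℝ) - g (v + (c + Pi.single j w))) ∂(PP n) := by
  rw [integral_resample j (hg.int2 _ _)]
  have hpos : 0 ≤ w * phi R := mul_nonneg hw (phi_pos R).le
  have : ∀ v, w * phi R * F v ≤ ∫ x, ((g (Function.update v j x + c) : ℝ) -
      g (Function.update v j x + (c + Pi.single j w))) ∂gam := by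
    intro v
    have h1 := neg_abs_le (c j)
    have h2 := le_abs_self (c j)
    have := oneD_lower (a := -K - c j) (b := K - c j) (R := R)
      (hg.line (v + c) j (c j)) (fun a b => hg.osc _ _ _ _) hw (by linarith) (by linarith)
      (by linarith)
    simp only [update_add_single]
    simp only [update_add' v c]
    simp only [add_right_comm _ w (c j), sub_add_cancel] at this
    exact (mul_le_mul_of_nonneg_left (hF' v) hpos).trans this
  calc _ ≤ w * phi R * ∫ v, F v ∂(PP n) := mul_le_mul_of_nonneg_left hq hpos
    _ = ∫ v, w * phi R * F v ∂(PP n) := (integral_const_mul _ _).symm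
    _ ≤ _ := integral_mono (hF.const_mul _)
        (integrable_resample j (hg.int2 _ _)) this

def ind {n : ℕ} (S : Finset (Fin n)) (w : ℝ) : Fin n → ℝ := fun i => if i ∈ S then w else 0

lemma ind_insert {n : ℕ} {S : Finset (Fin n)} {j : Fin n} (hj : j ∉ S) (w : ℝ) :
    ind (insert j S) w = ind S w + Pi.single j w := by
  ext i
  by_cases h : i = j
  · subst h; simp [ind, hj]
  · simp [ind, h]

lemma Good.upper {n : ℕ} {g : (Fin n → ℝ) → ℕ} (hg : Good g) (c : Fin n → ℝ)
    {w : ℝ} (hw : 0 ≤ w) (S : Finset (Fin n)) :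
    ∫ v, ((g (v + c) : ℝ) - g (v + (c + ind S w))) ∂(PP n) ≤ S.card * w := by
  induction S using Finset.induction_on with
  | empty => 
    have : ind (∅ : Finset (Fin n)) w = 0 := by ext; simp [ind]
    simp [this]
  | insert j S hj ih =>
    have h1 := hg.site_upper (c + ind S w) j hw
    rw [integral_sub (hg.int _) (hg.int _)] at *
    rw [ind_insert hj, ← add_assoc, Finset.card_insert_of_notMem hj]
    push_cast
    linarith

lemma Good.lower {n : ℕ} {g : (Fin n → ℝ) → ℕ} (hg : Good g) (c : Fin n → ℝ)
    {w q : ℝ} (S : Finset (Fin n))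
    (h : ∀ S j, q ≤ ∫ v, ((g (v + (c + ind S w)) : ℝ) -
      g (v + (c + ind S w + Pi.single j w))) ∂(PP n)) :
    S.card * q ≤ ∫ v, ((g (v + c) : ℝ) - g (v + (c + ind S w))) ∂(PP n) := by
  induction S using Finset.induction_on with
  | empty => 
    have : ind (∅ : Finset (Fin n)) w = 0 := by ext; simp [ind]
    simp [this]
  | insert j S hj ih =>
    have h1 := h S j
    rw [integral_sub (hg.int _) (hg.int _)] at *
    rw [ind_insert hj, ← add_assoc, Finset.card_insert_of_notMem hj]
    push_cast
    linarith

lemma var_bound {L : ℝ} (hL : 0 ≤ L) : ∀ (n : ℕ) (f : (Fin n → ℝ) → ℝ) (B : ℝ), Measurable f →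
    (∀ u, |f u| ≤ B) →
    (∀ u j a b, |f (Function.update u j a) - f (Function.update u j b)| ≤ L) →
    ∫ v, f v ^ 2 ∂(PP n) ≤ (∫ v, f v ∂(PP n)) ^ 2 + n * L ^ 2 := by
  intro n
  induction n with
  | zero =>
    intro f B hf hB ho
    have h1 : ∀ v, f v = f 0 := fun v => by rw [Subsingleton.elim v 0]
    simp only [h1]
    simp
  | succ n ih =>
    intro f B hf hB ho
    have hB0 : 0 ≤ B := (abs_nonneg _).trans (hB 0)
    let e := MeasurableEquiv.piFinSuccAbove (fun _ : Fin (n + 1) => ℝ) 0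
    have he : MeasurePreserving e (PP (n + 1)) (gam.prod (PP n)) :=
      measurePreserving_piFinSuccAbove (fun _ => gaussianReal 0 1) 0
    let F : ℝ × (Fin n → ℝ) → ℝ := fun p => f (e.symm p)
    have hF : Measurable F := hf.comp e.symm.measurable
    have hFc : ∀ x y, F (x, y) = f (Fin.cons x y) := by
      intro x y
      change f (Fin.insertNth 0 x y) = _
      rw [Fin.insertNth_zero']
    have hFB : ∀ p, |F p| ≤ B := fun p => hB _
    have hFint : Integrable F (gam.prod (PP n)) :=
      Integrable.of_bound hF.aestronglyMeasurable B (ae_of_all _ hFB)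
    have hF2B : ∀ p, |F p ^ 2| ≤ B ^ 2 := fun p => by
      rw [abs_pow]; exact pow_le_pow_left₀ (abs_nonneg _) (hFB p) 2
    have hF2int : Integrable (fun p => F p ^ 2) (gam.prod (PP n)) :=
      Integrable.of_bound (hF.pow_const 2).aestronglyMeasurable (B ^ 2) (ae_of_all _ hF2B)
    have t1 : ∀ G : (Fin (n + 1) → ℝ) → ℝ, ∫ v, G v ∂(PP (n + 1)) =
        ∫ p, G (e.symm p) ∂(gam.prod (PP n)) := by
      intro G
      exact (he.symm.integral_comp' G).symm
    let m : (Fin n → ℝ) → ℝ := fun y => ∫ x, F (x, y) ∂gam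
    have hm : Measurable m :=
      (hF.stronglyMeasurable.integral_prod_left (μ := gam)).measurable
    have hsl : ∀ y, Measurable (fun x => F (x, y)) := fun y => hF.comp measurable_prodMk_right
    have hi : ∀ y, Integrable (fun x => F (x, y)) gam := fun y =>
      Integrable.of_bound (hsl y).aestronglyMeasurable B (ae_of_all _ fun x => hFB _)
    have hi2 : ∀ y, Integrable (fun x => F (x, y) ^ 2) gam := fun y =>
      Integrable.of_bound ((hsl y).pow_const 2).aestronglyMeasurable (B ^ 2)
        (ae_of_all _ fun x => hF2B _)
    have hmB : ∀ y, |m y| ≤ B := by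
      intro y
      have := norm_integral_le_of_norm_le_const (μ := gam) (f := fun x => F (x, y)) (C := B)
        (ae_of_all _ fun x => hFB _)
      simpa using this
    have hmo : ∀ u j a b, |m (Function.update u j a) - m (Function.update u j b)| ≤ L := by
      intro u j a b
      rw [← integral_sub (hi _) (hi _)]
      have := norm_integral_le_of_norm_le_const (μ := gam)
        (f := fun x => F (x, Function.update u j a) - F (x, Function.update u j b)) (C := L)
        (ae_of_all _ fun x => by
          rw [hFc, hFc, Fin.cons_update, Fin.cons_update]
          exact ho _ _ _ _)
      simpa using this
    have hsite : ∀ y, ∫ x, F (x, y) ^ 2 ∂gam ≤ m y ^ 2 + L ^ 2 := by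
      intro y
      have hFo : ∀ x x', |F (x, y) - F (x', y)| ≤ L := by
        intro x x'
        have := ho (Fin.cons x y) 0 x x'
        rw [Fin.update_cons_zero, Fin.update_cons_zero] at this
        rw [hFc, hFc]; exact this
      have hd : ∀ x, |F (x, y) - m y| ≤ L := by
        intro x
        have h3 : F (x, y) - m y = ∫ x', (F (x, y) - F (x', y)) ∂gam := by
          rw [integral_sub (integrable_const _) (hi y)]; simp [m]
        rw [h3]
        have := norm_integral_le_of_norm_le_const (μ := gam)
          (f := fun x' => F (x, y) - F (x', y)) (C := L) (ae_of_all _ fun x' => hFo x x')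
        simpa using this
      have hd2 : ∀ x, F (x, y) ^ 2 ≤ L ^ 2 + 2 * m y * F (x, y) - m y ^ 2 := by
        intro x
        have := pow_le_pow_left₀ (abs_nonneg _) (hd x) 2
        rw [sq_abs] at this
        nlinarith
      calc ∫ x, F (x, y) ^ 2 ∂gam ≤ ∫ x, (L ^ 2 + 2 * m y * F (x, y) - m y ^ 2) ∂gam := by
            refine integral_mono (hi2 y) ?_ hd2
            exact ((integrable_const _).add ((hi y).const_mul _)).sub (integrable_const _)
        _ = ∫ x, (2 * m y * F (x, y) + (L ^ 2 - m y ^ 2)) ∂gam := by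
            congr 1; ext x; ring
        _ = 2 * m y * m y + (L ^ 2 - m y ^ 2) := by
            rw [integral_add ((hi y).const_mul _) (integrable_const _), integral_const_mul]
            simp [m]
        _ = _ := by ring
    have hmint2 : Integrable (fun y => m y ^ 2) (PP n) := by
      refine Integrable.of_bound (hm.pow_const 2).aestronglyMeasurable (B ^ 2)
        (ae_of_all _ fun y => ?_)
      rw [Real.norm_eq_abs, abs_pow]; exact pow_le_pow_left₀ (abs_nonneg _) (hmB y) 2
    have e1 : ∫ v, f v ∂(PP (n + 1)) = ∫ y, m y ∂(PP n) := by
      rw [t1, integral_prod_symm _ hFint]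
    have e2 : ∫ v, f v ^ 2 ∂(PP (n + 1)) = ∫ y, ∫ x, F (x, y) ^ 2 ∂gam ∂(PP n) := by
      rw [t1, integral_prod_symm _ hF2int]
    rw [e1, e2]
    calc ∫ y, ∫ x, F (x, y) ^ 2 ∂gam ∂(PP n) ≤ ∫ y, (m y ^ 2 + L ^ 2) ∂(PP n) :=
          integral_mono hF2int.integral_prod_right (hmint2.add (integrable_const _)) hsite
      _ = ∫ y, m y ^ 2 ∂(PP n) + L ^ 2 := by
          rw [integral_add hmint2 (integrable_const _)]; simp
      _ ≤ _ := by
          have := ih m B hm hmB hmo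
          push_cast; linarith

lemma cheb {n : ℕ} {L s : ℝ} (hL : 0 ≤ L) (hs : 0 < s) (f : (Fin n → ℝ) → ℝ) (B : ℝ)
    (hf : Measurable f) (hB : ∀ u, |f u| ≤ B)
    (ho : ∀ u j a b, |f (Function.update u j a) - f (Function.update u j b)| ≤ L) :
    (PP n) {v | s ≤ |f v - ∫ v, f v ∂(PP n)|} ≤ ENNReal.ofReal (n * L ^ 2 / s ^ 2) := by
  have hm : MemLp f 2 (PP n) := MemLp.of_bound hf.aestronglyMeasurable B (ae_of_all _ hB)
  refine (meas_ge_le_variance_div_sq hm hs).trans (ENNReal.ofReal_le_ofReal ?_)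
  rw [variance_eq_sub hm]
  have := var_bound hL n f B hf hB ho
  simp only [Pi.pow_apply]
  gcongr
  linarith

lemma diff_osc {n : ℕ} {g : (Fin n → ℝ) → ℕ} (hg : Good g) (c c' : Fin n → ℝ)
    (u : Fin n → ℝ) (j : Fin n) (a b : ℝ) :
    |((g (Function.update u j a + c) : ℝ) - g (Function.update u j a + c')) -
      ((g (Function.update u j b + c) : ℝ) - g (Function.update u j b + c'))| ≤ 2 := by
  simp only [update_add']
  have h1 := hg.osc (u + c) j (a + c j) (b + c j)
  have h2 := hg.osc (u + c) j (b + c j) (a + c j)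
  have h3 := hg.osc (u + c') j (a + c' j) (b + c' j)
  have h4 := hg.osc (u + c') j (b + c' j) (a + c' j)
  rify at h1 h2 h3 h4
  rw [abs_le]
  constructor <;> linarith

lemma diff_cheb {n : ℕ} {g : (Fin n → ℝ) → ℕ} (hg : Good g) (c c' : Fin n → ℝ) {s : ℝ}
    (hs : 0 < s) :
    (PP n) {v | s ≤ |((g (v + c) : ℝ) - g (v + c')) -
      ∫ v, ((g (v + c) : ℝ) - g (v + c')) ∂(PP n)|} ≤ ENNReal.ofReal (n * 2 ^ 2 / s ^ 2) := by
  refine cheb (by norm_num) hs (fun v => (g (v + c) : ℝ) - g (v + c')) n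
    ((hg.meas' c).sub (hg.meas' c')) (fun u => ?_) (diff_osc hg c c')
  have h1 : (g (u + c) : ℝ) ≤ n := by exact_mod_cast hg.le _
  have h2 : (g (u + c') : ℝ) ≤ n := by exact_mod_cast hg.le _
  have h3 : (0 : ℝ) ≤ g (u + c) := by positivity
  have h4 : (0 : ℝ) ≤ g (u + c') := by positivity
  rw [abs_le]
  constructor <;> linarith

lemma exp_lower {n : ℕ} {A : Matrix (Fin n) (Fin n) ℝ} (hA : ∀ i k, A i k = A k i)
    (hd : ∀ j, A j j = 0) {t : ℝ} (ht : ∀ j k, |A j k| ≤ t) {d : ℕ} (hd0 : 0 < d)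
    (hS : ∀ j, (Finset.univ.filter (fun k => A j k ≠ 0)).card = d)
    (c : Fin n → ℝ) {C R w : ℝ} (hw : 0 ≤ w) (hC : ∀ i, |c i| ≤ C)
    (hR : (1 + 4 * d ^ 2 * t ^ 2) + w + (C + w) ≤ R) :
    n * (w * phi R * (1 / 2)) ≤
      ∫ v, ((nn A (v + c) : ℝ) - nn A (v + (c + ind Finset.univ w))) ∂(PP n) := by
  have hg := good_nn hA
  have key := hg.lower c (w := w) (q := w * phi R * (1 / 2)) Finset.univ ?_
  · simpa using key
  intro S j
  set T := Finset.univ.filter (fun k => A j k ≠ 0) with hT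
  have hd' : (0 : ℝ) < d := by exact_mod_cast hd0
  set δ : ℝ := 1 / (4 * d) with hδ
  have hδ0 : 0 < δ := by positivity
  set K : ℝ := 1 + 4 * d ^ 2 * t ^ 2 with hK
  have hK0 : 0 ≤ K := by positivity
  have hgd := good_dec hA j
  set c0 := c + ind S w with hc0
  have hδT : ∀ u : Fin n → ℝ, (fun i => u i - if i ∈ T then δ else 0) = u + - ind T δ := by
    intro u; ext i; simp [ind, sub_eq_add_neg]
  have hδT' : ∀ u : Fin n → ℝ, (fun i => u i + if i ∈ T then δ else 0)
      = u + (- ind T δ + ind T (2 * δ)) := by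
    intro u; ext i
    simp only [ind, Pi.add_apply, Pi.neg_apply]
    split_ifs <;> ring
  have hI := hgd.int2 (c0 + - ind T δ) (c0 + - ind T δ + ind T (2 * δ))
  have hub := hgd.upper (c0 + - ind T δ) (w := 2 * δ) (by positivity) T
  refine hg.site_lower c0 j (K := K) hw hK0 ?_
    (F := fun v => 1 - ((nn (dec A j) (Function.update (v + (c0 + - ind T δ)) j 1) : ℝ) -
      nn (dec A j) (Function.update (v + (c0 + - ind T δ + ind T (2 * δ))) j 1)))
    ((integrable_const _).sub hI) ?_ ?_
  · have h1 : |c0 j| ≤ C + w := by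
      rw [hc0, Pi.add_apply]
      refine (abs_add_le _ _).trans (add_le_add (hC j) ?_)
      simp only [ind]
      split_ifs
      · rw [abs_of_nonneg hw]
      · simpa using hw
    linarith
  · rw [integral_sub (integrable_const _) hI]
    rw [hS j] at hub
    have : (d : ℝ) * (2 * δ) = 1 / 2 := by rw [hδ]; field_simp; norm_num
    rw [this] at hub
    simp only [integral_const, probReal_univ, smul_eq_mul, one_mul]
    linarith
  · intro v
    have := decouple hA j (hd j) T (by simp [hT, hd j]) (by simp [hT]) (ht j) hδ0 (K := K)
      (by rw [hS j, hK, hδ]; apply le_of_eq; field_simp) (v + c0)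
    rw [hδT, hδT'] at this
    rify at this
    rw [← add_assoc v c0, add_assoc c0, ← add_assoc v c0]
    linarith

lemma exists_diffset {d N : ℕ} (h1 : d + 1 ≤ N) (h2 : Even (N * d)) :
    ∃ D : Finset ℕ, (∀ m ∈ D, 0 < m ∧ m < N ∧ N - m ∈ D) ∧ D.card = d := by
  rcases Nat.even_or_odd' d with ⟨k, hk | hk⟩
  · refine ⟨Finset.Icc 1 k ∪ Finset.Icc (N - k) (N - 1), ?_, ?_⟩
    · intro m hm
      simp only [Finset.mem_union, Finset.mem_Icc] at hm ⊢
      omega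
    · rw [Finset.card_union_of_disjoint]
      · simp only [Nat.card_Icc]; omega
      · rw [Finset.disjoint_left]
        intro m hm hm'
        simp only [Finset.mem_Icc] at hm hm'
        omega
  · have hN : Even N := by
      rcases Nat.even_mul.mp h2 with h | h
      · exact h
      · exfalso; rw [hk] at h; exact (Nat.not_even_iff_odd.mpr ⟨k, rfl⟩) h
    obtain ⟨l, hl⟩ := hN
    refine ⟨insert l (Finset.Icc 1 k ∪ Finset.Icc (N - k) (N - 1)), ?_, ?_⟩
    · intro m hm
      simp only [Finset.mem_insert, Finset.mem_union, Finset.mem_Icc] at hm ⊢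
      omega
    · rw [Finset.card_insert_of_notMem, Finset.card_union_of_disjoint]
      · simp only [Nat.card_Icc]; omega
      · rw [Finset.disjoint_left]
        intro m hm hm'
        simp only [Finset.mem_Icc] at hm hm'
        omega
      · simp only [Finset.mem_union, Finset.mem_Icc]; omega

lemma exists_reg {d N : ℕ} (h1 : d + 1 ≤ N) (h2 : Even (N * d)) :
    {a | IsRegAdj d N a}.Nonempty := by
  obtain ⟨D, hD, hc⟩ := exists_diffset h1 h2
  have : NeZero N := ⟨by omega⟩
  have hneg : ∀ x : Fin N, x.val ∈ D → (-x).val ∈ D := by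
    intro x hx
    obtain ⟨p1, p2, p3⟩ := hD _ hx
    rw [Fin.val_neg', Nat.mod_eq_of_lt (by omega)]
    exact p3
  refine ⟨fun i j => decide ((j - i).val ∈ D), ?_, ?_, ?_⟩
  · intro i j
    simp only [decide_eq_decide]
    constructor
    · intro h; have := hneg _ h; rwa [neg_sub] at this
    · intro h; have := hneg _ h; rwa [neg_sub] at this
  · intro i
    simp only [sub_self, decide_eq_false_iff_not]
    intro h
    have := (hD _ h).1
    simp at this
  · intro i
    rw [← hc]
    refine Finset.card_bij (fun j _ => (j - i).val) ?_ ?_ ?_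
    · intro j hj; simpa using hj
    · intro j _ k _ h
      have := Fin.val_injective h
      simpa using this
    · intro m hm
      refine ⟨(⟨m, (hD m hm).2.1⟩ : Fin N) + i, ?_, ?_⟩
      · simpa using hm
      · simp

lemma ms_lower (s : Multiset ℝ) (a b : ℝ) (I : Set ℝ) (hI : I = Set.Icc a b) :
    (s.filter (fun x => x < b)).card ≤
    (s.filter (fun x => x < a)).card + (s.filter (fun x => x ∈ I)).card := by
  induction s using Multiset.induction_on with
  | empty => simp
  | cons x s ih =>
    simp only [Multiset.filter_cons, Multiset.card_add]
    have h : x < b → x < a ∨ x ∈ I := by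
      intro hx
      by_cases h : x < a
      · exact Or.inl h
      · exact Or.inr (hI ▸ ⟨not_lt.mp h, hx.le⟩)
    by_cases h1 : x < b <;> by_cases h2 : x < a <;> by_cases h3 : x ∈ I <;>
      simp only [h1, h2, h3, if_true, if_false, Multiset.card_singleton, Multiset.card_zero] <;>
      first | omega | (exfalso; tauto)

lemma ms_upper (s : Multiset ℝ) {a b b' : ℝ} (I : Set ℝ) (hI : I = Set.Icc a b)
    (hab : a ≤ b') (h : b < b') :
    (s.filter (fun x => x ∈ I)).card + (s.filter (fun x => x < a)).card ≤
    (s.filter (fun x => x < b')).card := by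
  induction s using Multiset.induction_on with
  | empty => simp
  | cons x s ih =>
    simp only [Multiset.filter_cons, Multiset.card_add]
    have i1 : x ∈ I → x < b' ∧ ¬ x < a := by
      rw [hI]; intro hx; exact ⟨hx.2.trans_lt h, not_lt.mpr hx.1⟩
    have i2 : x < a → x < b' := fun hx => hx.trans_le hab
    by_cases h1 : x < b' <;> by_cases h2 : x < a <;> by_cases h3 : x ∈ I <;>
      simp only [h1, h2, h3, if_true, if_false, Multiset.card_singleton, Multiset.card_zero] <;>
      first | omega | (exfalso; tauto)

def Adj {N : ℕ} (t : ℝ) (a : Fin N → Fin N → Bool) : Matrix (Fin N) (Fin N) ℝ :=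
  fun i j => if a i j then -t else 0

lemma Wmat_eq {N : ℕ} (t : ℝ) (a : Fin N → Fin N → Bool) (v : Fin N → ℝ) :
    Wmat t a v = Adj t a + diagonal v := by
  ext i j
  simp [Wmat, Adj, diagonal_apply]

lemma prod_lower {d N : ℕ} (h1 : d + 1 ≤ N) (h2 : Even (N * d))
    (S : Set ((Fin N → Fin N → Bool) × (Fin N → ℝ))) (x : ℝ≥0∞)
    (h : ∀ a, IsRegAdj d N a → ∃ T : Set (Fin N → ℝ), MeasurableSet T ∧ (∀ v ∈ T, (a, v) ∈ S) ∧
      (PP N) Tᶜ ≤ x) : 1 - x ≤ graphMeasure d N S := by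
  choose! T hT hS hx using h
  have hfin : {a | IsRegAdj d N a}.Finite := Set.toFinite _
  have := isProbabilityMeasure_uniformOn hfin (exists_reg h1 h2)
  let U : Set ((Fin N → Fin N → Bool) × (Fin N → ℝ)) :=
    ⋃ a ∈ {a | IsRegAdj d N a}, ({a} : Set (Fin N → Fin N → Bool)) ×ˢ T a
  have hU : MeasurableSet U :=
    hfin.measurableSet_biUnion fun a ha => (measurableSet_singleton a).prod (hT a ha)
  have hUS : U ⊆ S := by
    rintro ⟨b, v⟩ hb
    simp only [U, Set.mem_iUnion, Set.mem_prod, Set.mem_singleton_iff] at hb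
    obtain ⟨a, ha, rfl, hv⟩ := hb
    exact hS _ ha v hv
  refine le_trans ?_ (measure_mono hUS)
  rw [graphMeasure, Measure.prod_apply hU]
  have hs1 : uniformOn {a | IsRegAdj d N a} {a | IsRegAdj d N a} = 1 :=
    uniformOn_self hfin (exists_reg h1 h2)
  calc 1 - x = ∫⁻ a in {a | IsRegAdj d N a}, (1 - x) ∂(uniformOn {a | IsRegAdj d N a}) := by
        rw [setLIntegral_const, hs1, mul_one]
    _ ≤ ∫⁻ a in {a | IsRegAdj d N a}, (PP N) (Prod.mk a ⁻¹' U)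
          ∂(uniformOn {a | IsRegAdj d N a}) := by
        refine setLIntegral_mono' hfin.measurableSet fun a ha => ?_
        have e : Prod.mk a ⁻¹' U = T a := by
          ext v
          simp only [U, Set.mem_preimage, Set.mem_iUnion, Set.mem_prod, Set.mem_singleton_iff]
          constructor
          · rintro ⟨b, hb, rfl, hv⟩; exact hv
          · intro hv; exact ⟨a, ha, rfl, hv⟩
        rw [e]
        have h3 := prob_compl_eq_one_sub (μ := PP N) (hT a ha).compl
        rw [compl_compl] at h3
        rw [h3]
        exact tsub_le_tsub_left (hx a ha) 1
    _ ≤ _ := setLIntegral_le_lintegral _ _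

lemma tendsto_one {d : ℕ} {f : ℕ → ℝ≥0∞} {C : ℝ} (hf : ∀ N, f N ≤ 1)
    (h : ∀ N, 0 < N → d + 1 ≤ N → Even (N * d) → 1 - ENNReal.ofReal (C / N) ≤ f N) :
    Tendsto f (admFilter d) (nhds 1) := by
  have h1 : Tendsto (fun N : ℕ => 1 - ENNReal.ofReal (C / N)) (admFilter d) (nhds 1) := by
    have h2 : Tendsto (fun N : ℕ => ENNReal.ofReal (C / N)) (admFilter d) (nhds 0) := by
      have := (tendsto_const_div_atTop_nhds_zero_nat C).mono_left
        (inf_le_left : admFilter d ≤ atTop)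
      have h5 := ENNReal.tendsto_ofReal this
      rwa [ENNReal.ofReal_zero] at h5
    have h3 := ENNReal.Tendsto.sub (tendsto_const_nhds (x := (1 : ℝ≥0∞)) (f := admFilter d)) h2
      (Or.inl ENNReal.one_ne_top)
    simpa using h3
  refine tendsto_of_tendsto_of_tendsto_of_le_of_le' h1 tendsto_const_nhds ?_
    (Eventually.of_forall hf)
  have h4 : ∀ᶠ N in admFilter d, d + 1 ≤ N ∧ Even (N * d) :=
    (inf_le_right : admFilter d ≤ _) (mem_principal_self _)
  filter_upwards [h4] with N hN
  exact h N (by omega) hN.1 hN.2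

lemma graphMeasure_le_one (d N : ℕ) (S : Set ((Fin N → Fin N → Bool) × (Fin N → ℝ))) :
    graphMeasure d N S ≤ 1 := by
  have hfin : {a | IsRegAdj d N a}.Finite := Set.toFinite _
  rcases Set.eq_empty_or_nonempty {a | IsRegAdj d N a} with h | h
  · rw [graphMeasure, h]; simp
  · have := isProbabilityMeasure_uniformOn hfin h
    rw [graphMeasure]
    exact prob_le_one

lemma eig_lower {N : ℕ} {t : ℝ} {a : Fin N → Fin N → Bool} (ha : ∀ i j, a i j = a j i)
    (v : Fin N → ℝ) (E η : ℝ) (hη : 0 < η) :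
    (nn (Adj t a) (v + fun _ => (-E - η)) : ℝ) -
      nn (Adj t a) (v + ((fun _ => (-E - η)) + ind Finset.univ (2 * η))) ≤
      eigCountIn (Wmat t a v) (Set.Icc (E - η) (E + η)) := by
  have hA : ∀ i k, Adj t a i k = Adj t a k i := fun i k => by simp [Adj, ha i k]
  have h := ms_lower (Wmat t a v).charpoly.roots (E - η) (E + η) _ rfl
  change cnt _ _ ≤ cnt _ _ + eigCountIn _ _ at h
  rw [Wmat_eq, cnt_eq_nn hA, cnt_eq_nn hA, ← Wmat_eq] at h
  have e1 : (fun i => v i - (E + η)) = v + fun _ => (-E - η) := by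
    ext i; simp; ring
  have e2 : (fun i => v i - (E - η)) = v + ((fun _ => (-E - η)) + ind Finset.univ (2 * η)) := by
    ext i; simp [ind]; ring
  rw [e1, e2] at h
  rify at h
  linarith

lemma eig_upper {N : ℕ} {t : ℝ} {a : Fin N → Fin N → Bool} (ha : ∀ i j, a i j = a j i)
    (v : Fin N → ℝ) (E η : ℝ) (hη : 0 < η) :
    eigCountIn (Wmat t a v) (Set.Icc (E - η) (E + η)) ≤
    (nn (Adj t a) (v + fun _ => (-E - 2 * η)) : ℝ) -
      nn (Adj t a) (v + ((fun _ => (-E - 2 * η)) + ind Finset.univ (3 * η))) := by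
  have hA : ∀ i k, Adj t a i k = Adj t a k i := fun i k => by simp [Adj, ha i k]
  have h := ms_upper (Wmat t a v).charpoly.roots (a := E - η) (b := E + η) (b' := E + 2 * η)
    _ rfl (by linarith) (by linarith)
  change eigCountIn _ _ + cnt _ _ ≤ cnt _ _ at h
  rw [Wmat_eq, cnt_eq_nn hA, cnt_eq_nn hA, ← Wmat_eq] at h
  have e1 : (fun i => v i - (E + 2 * η)) = v + fun _ => (-E - 2 * η) := by
    ext i; simp; ring
  have e2 : (fun i => v i - (E - η)) =
      v + ((fun _ => (-E - 2 * η)) + ind Finset.univ (3 * η)) := by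
    ext i; simp [ind]; ring
  rw [e1, e2] at h
  rify at h
  linarith

theorem stmt4 (t M : ℝ) (ht : 0 < t) (hM : 0 < M) (d : ℕ) (hd : 10 ≤ d) :
    ∃ c : ℝ, 0 < c ∧
      ∀ E : ℝ, E ∈ Set.Icc (-M) M → ∀ η : ℝ, η ∈ Set.Ioo (0 : ℝ) 1 →
        Tendsto
            (fun N : ℕ => graphMeasure d N
              {ω | c * N * η ≤
                (eigCountIn (Wmat t ω.1 ω.2) (Set.Icc (E - η) (E + η)) : ℝ)})
            (admFilter d) (nhds 1) ∧
        Tendsto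
            (fun N : ℕ => graphMeasure d N
              {ω | (eigCountIn (Wmat t ω.1 ω.2) (Set.Icc (E - η) (E + η)) : ℝ) ≤
                c⁻¹ * N * η})
            (admFilter d) (nhds 1) := by
  set R : ℝ := (1 + 4 * d ^ 2 * t ^ 2) + M + 7 with hR
  have hphi := phi_pos R
  refine ⟨min (phi R / 2) (1 / 4), lt_min (by positivity) (by norm_num), ?_⟩
  set c := min (phi R / 2) (1 / 4) with hc
  have hcpos : 0 < c := lt_min (by positivity) (by norm_num)
  intro E hE η hη
  obtain ⟨hη0, hη1⟩ := hη
  constructor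
  · refine tendsto_one (C := 16 / (η * phi R) ^ 2) (fun N => graphMeasure_le_one _ _ _) ?_
    intro N hN0 h1 h2
    have hN : (0 : ℝ) < N := by exact_mod_cast hN0
    refine prod_lower h1 h2 _ _ fun a ha => ?_
    obtain ⟨hs, hz, hdeg⟩ := ha
    have hA : ∀ i k, Adj t a i k = Adj t a k i := fun i k => by simp [Adj, hs i k]
    have hg := good_nn hA
    set c1 : Fin N → ℝ := fun _ => (-E - η) with hc1
    set c2 : Fin N → ℝ := c1 + ind Finset.univ (2 * η) with hc2
    have hexp := exp_lower hA (fun j => by simp [Adj, hz j]) (t := t)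
      (fun j k => by simp only [Adj]; split_ifs <;> simp [abs_of_pos ht, ht.le])
      (d := d) (by omega)
      (fun j => by
        rw [← hdeg j]; congr 1; ext k
        simp [Adj, ht.ne'])
      c1 (C := M + 1) (R := R) (w := 2 * η) (by positivity)
      (fun i => by
        rw [hc1, abs_le]; constructor <;> linarith [hE.1, hE.2])
      (by rw [hR]; linarith)
    set m := ∫ v, ((nn (Adj t a) (v + c1) : ℝ) - nn (Adj t a) (v + c2)) ∂(PP N) with hm
    have hs0 : 0 < N * η * phi R / 2 := by positivity
    have hch := diff_cheb hg c1 c2 hs0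
    have hmeas : Measurable (fun v => ((nn (Adj t a) (v + c1) : ℝ) - nn (Adj t a) (v + c2)) - m) :=
      ((hg.meas' c1).sub (hg.meas' c2)).sub_const m
    refine ⟨{v | N * η * phi R / 2 ≤
      |((nn (Adj t a) (v + c1) : ℝ) - nn (Adj t a) (v + c2)) - m|}ᶜ, ?_, ?_, ?_⟩
    · exact (measurableSet_le measurable_const hmeas.abs).compl
    · intro v hv
      have hv' : ¬ (N * η * phi R / 2 ≤
        |((nn (Adj t a) (v + c1) : ℝ) - nn (Adj t a) (v + c2)) - m|) := hv
      have h3 := (abs_lt.mp (not_le.mp hv')).1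
      have h4 := eig_lower (t := t) hs v E η hη0
      have h5 : c * N * η ≤ phi R / 2 * N * η := by
        gcongr; exact min_le_left _ _
      change c * N * η ≤ (eigCountIn (Wmat t a v) (Set.Icc (E - η) (E + η)) : ℝ)
      linarith
    · rw [compl_compl]
      refine hch.trans (ENNReal.ofReal_le_ofReal (le_of_eq ?_))
      field_simp
      norm_num
  · refine tendsto_one (C := 4 / η ^ 2) (fun N => graphMeasure_le_one _ _ _) ?_
    intro N hN0 h1 h2
    have hN : (0 : ℝ) < N := by exact_mod_cast hN0
    refine prod_lower h1 h2 _ _ fun a ha => ?_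
    obtain ⟨hs, hz, hdeg⟩ := ha
    have hA : ∀ i k, Adj t a i k = Adj t a k i := fun i k => by simp [Adj, hs i k]
    have hg := good_nn hA
    set c1 : Fin N → ℝ := fun _ => (-E - 2 * η) with hc1
    set c2 : Fin N → ℝ := c1 + ind Finset.univ (3 * η) with hc2
    have hexp := hg.upper c1 (w := 3 * η) (by positivity) Finset.univ
    rw [Finset.card_univ, Fintype.card_fin] at hexp
    set m := ∫ v, ((nn (Adj t a) (v + c1) : ℝ) - nn (Adj t a) (v + c2)) ∂(PP N) with hm
    have hs0 : 0 < N * η := by positivity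
    have hch := diff_cheb hg c1 c2 hs0
    have hmeas : Measurable (fun v => ((nn (Adj t a) (v + c1) : ℝ) - nn (Adj t a) (v + c2)) - m) :=
      ((hg.meas' c1).sub (hg.meas' c2)).sub_const m
    refine ⟨{v | N * η ≤
      |((nn (Adj t a) (v + c1) : ℝ) - nn (Adj t a) (v + c2)) - m|}ᶜ, ?_, ?_, ?_⟩
    · exact (measurableSet_le measurable_const hmeas.abs).compl
    · intro v hv
      have hv' : ¬ (N * η ≤
        |((nn (Adj t a) (v + c1) : ℝ) - nn (Adj t a) (v + c2)) - m|) := hv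
      have h3 := (abs_lt.mp (not_le.mp hv')).2
      have h4 := eig_upper (t := t) hs v E η hη0
      have h6 : 4 ≤ c⁻¹ := by
        rw [le_inv_comm₀ (by norm_num) hcpos]
        refine (min_le_right _ _).trans (by norm_num)
      have h5 : 4 * N * η ≤ c⁻¹ * N * η := by gcongr
      change (eigCountIn (Wmat t a v) (Set.Icc (E - η) (E + η)) : ℝ) ≤ c⁻¹ * N * η
      linarith
    · rw [compl_compl]
      refine hch.trans (ENNReal.ofReal_le_ofReal (le_of_eq ?_))
      field_simp
      norm_num
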